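/- Let p ∈ C_q^s(n,k) be a synchronous quantum correlation induced by a strategy S = (ψ ∈ ℂ^{d_A} ⊗ ℂ^{d_B}, {E_{v,i}}, {F_{w,j}}). Then there exist r ∈ ℕ and a strategy S' = (ψ' ∈ ℂ^r ⊗ ℂ^r, {E'_{v,i}}, {F'_{w,j}}) such that ψ' has full Schmidt rank and S' is a local dilation of S. -/

import Mathlib

open scoped Matrix Kronecker ComplexOrder

noncomputable section
namespace QST

/-- Euclidean norm of a finite complex vector. -/
def evnorm {ι : Type} [Fintype ι] (v : ι → ℂ) : ℝ :=
  Real.sqrt (∑ i, ‖v i‖ ^ 2)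

/-- Inner product `⟨v, w⟩`, linear in the first argument. -/
def pinner {ι : Type} [Fintype ι] (v w : ι → ℂ) : ℂ :=
  ∑ i, v i * (starRingEnd ℂ) (w i)

/-- Reduced density matrix of `ψψ*` on the first tensor factor. -/
def rhoA {dA dB : ℕ} (ψ : Fin dA × Fin dB → ℂ) : Matrix (Fin dA) (Fin dA) ℂ :=
  Matrix.of fun a a' => ∑ b, ψ (a, b) * (starRingEnd ℂ) (ψ (a', b))

/-- Reduced density matrix of `ψψ*` on the second tensor factor. -/
def rhoB {dA dB : ℕ} (ψ : Fin dA × Fin dB → ℂ) : Matrix (Fin dB) (Fin dB) ℂ :=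
  Matrix.of fun b b' => ∑ a, ψ (a, b) * (starRingEnd ℂ) (ψ (a, b'))

/-- The state-dependent seminorm `‖X‖_ρ = (tr (X* X ρ))^(1/2)`. -/
def rnorm {d : ℕ} (ρ X : Matrix (Fin d) (Fin d) ℂ) : ℝ :=
  Real.sqrt ((Xᴴ * X * ρ).trace).re

/-- Operator (spectral) norm of a matrix. -/
def opNorm {d : ℕ} (X : Matrix (Fin d) (Fin d) ℂ) : ℝ :=
  ‖Matrix.toEuclideanCLM (𝕜 := ℂ) X‖

/-- `P = P* = P²`. -/
def IsProjection {d : ℕ} (P : Matrix (Fin d) (Fin d) ℂ) : Prop :=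
  Pᴴ = P ∧ P * P = P

/-- 1-norm distance between correlations. -/
def dist1 {n k : ℕ} (p q : Fin n → Fin n → Fin k → Fin k → ℝ) : ℝ :=
  ∑ v, ∑ w, ∑ i, ∑ j, |p v w i j - q v w i j|

/-- Membership in the set `C_q(n,k)` of quantum correlations. -/
def IsQuantumCorrelation (n k : ℕ) (p : Fin n → Fin n → Fin k → Fin k → ℝ) : Prop :=
  ∃ (dA dB : ℕ) (ψ : Fin dA × Fin dB → ℂ)
    (E : Fin n → Fin k → Matrix (Fin dA) (Fin dA) ℂ)
    (F : Fin n → Fin k → Matrix (Fin dB) (Fin dB) ℂ),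
    evnorm ψ = 1 ∧ (∀ v i, (E v i).PosSemidef) ∧ (∀ v, ∑ i, E v i = 1) ∧
    (∀ w j, (F w j).PosSemidef) ∧ (∀ w, ∑ j, F w j = 1) ∧
    ∀ v w i j, (p v w i j : ℂ) = pinner ((E v i ⊗ₖ F w j).mulVec ψ) ψ

/-- Strategy 1 (the "tilde" strategy) is a local `ε`-dilation of strategy 2. -/
def IsLocalDilation {n k : ℕ} (ε : ℝ) {d1A d1B d2A d2B : ℕ}
    (ψ1 : Fin d1A × Fin d1B → ℂ)
    (E1 : Fin n → Fin k → Matrix (Fin d1A) (Fin d1A) ℂ)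
    (F1 : Fin n → Fin k → Matrix (Fin d1B) (Fin d1B) ℂ)
    (ψ2 : Fin d2A × Fin d2B → ℂ)
    (E2 : Fin n → Fin k → Matrix (Fin d2A) (Fin d2A) ℂ)
    (F2 : Fin n → Fin k → Matrix (Fin d2B) (Fin d2B) ℂ) : Prop :=
  ∃ (kA kB : ℕ) (VA : Matrix (Fin d1A × Fin kA) (Fin d2A) ℂ)
    (VB : Matrix (Fin d1B × Fin kB) (Fin d2B) ℂ) (χ : Fin kA × Fin kB → ℂ),
    VAᴴ * VA = 1 ∧ VBᴴ * VB = 1 ∧ evnorm χ = 1 ∧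
    evnorm (fun y : (Fin d1A × Fin d1B) × (Fin kA × Fin kB) =>
        ((VA ⊗ₖ VB).mulVec ψ2) ((y.1.1, y.2.1), (y.1.2, y.2.2)) - ψ1 y.1 * χ y.2) ≤ ε ∧
    ∀ (v w : Fin n) (i j : Fin k),
      evnorm (fun y : (Fin d1A × Fin d1B) × (Fin kA × Fin kB) =>
        ((VA ⊗ₖ VB).mulVec ((E2 v i ⊗ₖ F2 w j).mulVec ψ2)) ((y.1.1, y.2.1), (y.1.2, y.2.2))
          - ((E1 v i ⊗ₖ F1 w j).mulVec ψ1) y.1 * χ y.2) ≤ ε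

/-- The sequence generating `Λ_n` for `n ≥ 4`. -/
def lambdaSeq (n : ℕ) : ℕ → ℝ
  | 0 => 0
  | l + 1 => 1 + 1 / ((n : ℝ) - 1 - lambdaSeq n l)

/-- The sets `Λ_n`. -/
def Lambda (n : ℕ) : Set ℝ :=
  if n = 3 then {3 / 2} else Set.range (lambdaSeq n)

/-- The maximally entangled state `φ_d`. -/
def phid (d : ℕ) : Fin d × Fin d → ℂ :=
  fun y => if y.1 = y.2 then (((Real.sqrt d)⁻¹ : ℝ) : ℂ) else 0

/-- The two-outcome measurement `{M, 1 - M}`. -/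
def canonPair {d : ℕ} (M : Matrix (Fin d) (Fin d) ℂ) : Fin 2 → Matrix (Fin d) (Fin d) ℂ :=
  fun i => if i = 0 then M else 1 - M

theorem exists_isom {m n : ℕ} (A : Matrix (Fin m) (Fin n) ℂ) (r : ℕ) (hr : A.rank = r) :
    ∃ U : Matrix (Fin m) (Fin r) ℂ, Uᴴ * U = 1 ∧ U * (Uᴴ * A) = A := by
  let S := LinearMap.range (Matrix.toEuclideanLin A)
  have hS : Module.finrank ℂ S = r := by
    rw [← hr, Matrix.rank_eq_finrank_range_toLin A
      (EuclideanSpace.basisFun (Fin m) ℂ).toBasis (EuclideanSpace.basisFun (Fin n) ℂ).toBasis,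
      ← Matrix.toEuclideanLin_eq_toLin_orthonormal]
  let b : OrthonormalBasis (Fin r) ℂ S := (stdOrthonormalBasis ℂ S).reindex (finCongr hS)
  refine ⟨Matrix.of fun a i => (b i : EuclideanSpace ℂ (Fin m)) a, ?_, ?_⟩
  · ext i j
    have h := orthonormal_iff_ite.mp b.orthonormal i j
    rw [Submodule.coe_inner, PiLp.inner_apply] at h
    simp only [Matrix.mul_apply, Matrix.conjTranspose_apply, Matrix.of_apply, Matrix.one_apply]
    rw [← h]
    refine Finset.sum_congr rfl fun a _ => ?_
    simp [mul_comm]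
  · ext a c
    let x : S := ⟨Matrix.toEuclideanLin A (EuclideanSpace.single c 1), LinearMap.mem_range_self _ _⟩
    have hx : ∀ a, (x : EuclideanSpace ℂ (Fin m)) a = A a c := by
      intro a
      simp [x, Matrix.toEuclideanLin]
    have h := congrArg (fun y : S => (y : EuclideanSpace ℂ (Fin m)) a) (b.sum_repr' x)
    simp only [hx] at h
    rw [← h]
    simp only [Matrix.mul_apply, Matrix.conjTranspose_apply, Matrix.of_apply]
    simp only [Submodule.coe_sum, WithLp.ofLp_sum, Finset.sum_apply, Submodule.coe_smul,
      PiLp.smul_apply, smul_eq_mul]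
    refine Finset.sum_congr rfl fun i _ => ?_
    rw [mul_comm, Submodule.coe_inner, PiLp.inner_apply]
    congr 1
    refine Finset.sum_congr rfl fun d _ => ?_
    rw [hx]
    simp [mul_comm]

theorem exists_dil {d r : ℕ} (i0 : Fin r) (U : Matrix (Fin d) (Fin r) ℂ) (hU : Uᴴ * U = 1) :
    ∃ V : Matrix (Fin r × Fin (d + 1)) (Fin d) ℂ, Vᴴ * V = 1 ∧
      V * U = Matrix.of fun p i => if p.2 = 0 then (if p.1 = i then 1 else 0) else 0 := by
  let Q : Matrix (Fin d) (Fin d) ℂ := 1 - U * Uᴴ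
  have hQU : Q * U = 0 := by
    simp only [Q]
    rw [Matrix.sub_mul, Matrix.mul_assoc, hU]; simp
  have hQQ : Qᴴ * Q = Q := by
    have : Qᴴ = Q := by simp [Q]
    rw [this]
    nth_rewrite 2 [show Q = 1 - U * Uᴴ from rfl]
    rw [mul_sub, ← Matrix.mul_assoc, hQU]; simp
  refine ⟨Matrix.of fun p a => Fin.cases (star (U a p.1))
    (fun c => if p.1 = i0 then Q c a else 0) p.2, ?_, ?_⟩
  · have h1 : (1 : Matrix (Fin d) (Fin d) ℂ) = U * Uᴴ + Qᴴ * Q := by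
      rw [hQQ]; simp [Q]
    rw [h1]
    ext a b
    simp only [Matrix.mul_apply, Matrix.conjTranspose_apply, Matrix.of_apply, Matrix.add_apply,
      Fintype.sum_prod_type_right, Fin.sum_univ_succ, Fin.cases_zero, Fin.cases_succ, star_star]
    congr 1
    refine Finset.sum_congr rfl fun c _ => ?_
    rw [Finset.sum_eq_single i0]
    · simp
    · intro x _ hx; simp [hx]
    · simp
  · ext ⟨p, q⟩ i
    refine Fin.cases ?_ (fun c => ?_) q
    · have := congrFun (congrFun hU p) i
      simpa [Matrix.mul_apply, Matrix.one_apply] using this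
    · have := congrFun (congrFun hQU c) i
      simp only [Matrix.mul_apply, Matrix.zero_apply] at this
      by_cases hp : p = i0
      · simpa [Matrix.mul_apply, hp, Fin.succ_ne_zero] using this
      · simp [Matrix.mul_apply, hp, Fin.succ_ne_zero]

theorem kron_mulVec {a b c d : Type} [Fintype a] [Fintype b] [Fintype c] [Fintype d]
    (A : Matrix a c ℂ) (B : Matrix b d ℂ) (ψ : c × d → ℂ) (x : a) (y : b) :
    ((A ⊗ₖ B).mulVec ψ) (x, y) = (A * (Matrix.of fun s t => ψ (s, t)) * Bᵀ) x y := by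
  simp only [Matrix.mulVec, dotProduct, Matrix.kroneckerMap_apply, Matrix.mul_apply,
    Matrix.of_apply, Matrix.transpose_apply, Fintype.sum_prod_type_right, Finset.sum_mul]
  refine Finset.sum_congr rfl fun t _ => Finset.sum_congr rfl fun s _ => ?_
  ring

theorem kron_mulVec' {a b c d : Type} [Fintype a] [Fintype b] [Fintype c] [Fintype d]
    (A : Matrix a c ℂ) (B : Matrix b d ℂ) (ψ : c × d → ℂ) :
    (Matrix.of fun s t => ((A ⊗ₖ B).mulVec ψ) (s, t))
      = (A * (Matrix.of fun s t => ψ (s, t)) * Bᵀ) := by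
  ext x y; exact kron_mulVec A B ψ x y

theorem evnorm_trace {a b : Type} [Fintype a] [Fintype b] (ψ : a × b → ℂ) :
    evnorm ψ = Real.sqrt (((Matrix.of fun s t => ψ (s, t))ᴴ *
      (Matrix.of fun s t => ψ (s, t))).trace).re := by
  unfold evnorm
  congr 1
  simp only [Matrix.trace, Matrix.diag, Matrix.mul_apply, Matrix.conjTranspose_apply,
    Matrix.of_apply, Fintype.sum_prod_type_right, Complex.re_sum]
  refine Finset.sum_congr rfl fun t _ => Finset.sum_congr rfl fun s _ => ?_
  rw [← Complex.normSq_eq_norm_sq, Complex.star_def, mul_comm, Complex.mul_conj]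
  simp

theorem evnorm_zero_le {a : Type} [Fintype a] (f : a → ℂ) (h : ∀ x, f x = 0) :
    evnorm f ≤ 0 := by
  simp [evnorm, h]

/-- From `E U N = U Y` with `N` invertible we get that `U` intertwines. -/
theorem intertwine {d r : ℕ} (U : Matrix (Fin d) (Fin r) ℂ) (hU : Uᴴ * U = 1)
    (N Y : Matrix (Fin r) (Fin r) ℂ) (hN : IsUnit N.det) (E : Matrix (Fin d) (Fin d) ℂ)
    (h : E * U * N = U * Y) : E * U = U * (Uᴴ * E * U) := by
  have h2 : E * U = U * (Y * N⁻¹) := by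
    rw [← Matrix.mul_assoc, ← h, Matrix.mul_nonsing_inv_cancel_right _ _ hN]
  have h3 : Uᴴ * E * U = Y * N⁻¹ := by
    rw [Matrix.mul_assoc, h2, ← Matrix.mul_assoc, hU, Matrix.one_mul]
  rw [h3, h2]

theorem statement5 {n k dA dB : ℕ}
    (ψ : Fin dA × Fin dB → ℂ)
    (E : Fin n → Fin k → Matrix (Fin dA) (Fin dA) ℂ)
    (F : Fin n → Fin k → Matrix (Fin dB) (Fin dB) ℂ)
    (hψ : evnorm ψ = 1)
    (hEpos : ∀ v i, (E v i).PosSemidef) (hEsum : ∀ v, ∑ i, E v i = 1)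
    (hFpos : ∀ w j, (F w j).PosSemidef) (hFsum : ∀ w, ∑ j, F w j = 1)
    (hsync : ∀ (v : Fin n) (i j : Fin k), i ≠ j →
      pinner ((E v i ⊗ₖ F v j).mulVec ψ) ψ = 0) :
    ∃ (r : ℕ) (ψ' : Fin r × Fin r → ℂ)
      (E' F' : Fin n → Fin k → Matrix (Fin r) (Fin r) ℂ),
      evnorm ψ' = 1 ∧ (∀ v i, (E' v i).PosSemidef) ∧ (∀ v, ∑ i, E' v i = 1) ∧
      (∀ w j, (F' w j).PosSemidef) ∧ (∀ w, ∑ j, F' w j = 1) ∧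
      IsUnit (Matrix.of fun a b => ψ' (a, b)).det ∧
      IsLocalDilation 0 ψ' E' F' ψ E F := by
  classical
  set M : Matrix (Fin dA) (Fin dB) ℂ := Matrix.of fun s t => ψ (s, t) with hM
  -- synchronicity
  have hz : ∀ v i j, i ≠ j → E v i * M * (F v j)ᵀ = 0 := by
    intro v i j hij
    have hp : (E v i ⊗ₖ F v j).PosSemidef := (hEpos v i).kronecker (hFpos v j)
    have h0 := hsync v i j hij
    have h1 : star ψ ⬝ᵥ (E v i ⊗ₖ F v j).mulVec ψ = 0 := by
      rw [← h0, dotProduct_comm]; rfl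
    have h2 := (hp.dotProduct_mulVec_zero_iff ψ).mp h1
    rw [← kron_mulVec', h2]
    ext; simp
  have hEF : ∀ v i, E v i * M = M * (F v i)ᵀ := by
    intro v i
    have a1 : E v i * M = E v i * M * (F v i)ᵀ := by
      calc E v i * M = E v i * M * (∑ j, F v j)ᵀ := by rw [hFsum]; simp
        _ = ∑ j, E v i * M * (F v j)ᵀ := by rw [Matrix.transpose_sum, Matrix.mul_sum]
        _ = _ := Finset.sum_eq_single i (fun j _ hj => hz v i j hj.symm) (by simp)
    have a2 : M * (F v i)ᵀ = E v i * M * (F v i)ᵀ := by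
      calc M * (F v i)ᵀ = (∑ j, E v j) * M * (F v i)ᵀ := by rw [hEsum]; simp
        _ = ∑ j, E v j * M * (F v i)ᵀ := by rw [Matrix.sum_mul, Matrix.sum_mul]
        _ = _ := Finset.sum_eq_single i (fun j _ hj => hz v j i hj) (by simp)
    rw [a1, ← a2]
  obtain ⟨U, hU, hUM⟩ := exists_isom M M.rank rfl
  obtain ⟨W, hW, hWM⟩ := exists_isom Mᵀ M.rank (Matrix.rank_transpose M)
  generalize hr : M.rank = r at U W
  let N : Matrix (Fin r) (Fin r) ℂ := Uᴴ * M * (Wᴴ)ᵀ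
  have hW' : Wᵀ * (Wᴴ)ᵀ = 1 := by
    rw [← Matrix.transpose_mul, hW, Matrix.transpose_one]
  have hWM' : M * (Wᴴ)ᵀ * Wᵀ = M := by
    have := congrArg Matrix.transpose hWM
    simpa [Matrix.transpose_mul, Matrix.mul_assoc] using this
  have hMN : U * N * Wᵀ = M := by
    calc U * N * Wᵀ = U * (Uᴴ * (M * (Wᴴ)ᵀ * Wᵀ)) := by simp only [N, Matrix.mul_assoc]
      _ = M := by rw [hWM', hUM]
  have hN : IsUnit N.det := by
    have h1 : r ≤ N.rank := by
      refine hr.symm.le.trans ?_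
      conv_lhs => rw [← hMN]
      exact (Matrix.rank_mul_le_left _ _).trans (Matrix.rank_mul_le_right _ _)
    have h2 : N.rank = Fintype.card (Fin r) :=
      le_antisymm (Matrix.rank_le_card_width N) (by simpa using h1)
    rw [← Matrix.isUnit_iff_isUnit_det]
    have hs : Function.Surjective N.mulVecLin := by
      rw [← LinearMap.range_eq_top]
      apply Submodule.eq_top_of_finrank_eq
      rw [Module.finrank_fintype_fun_eq_card]
      exact h2
    exact Matrix.mulVec_surjective_iff_isUnit.mp hs
  have hr0 : 0 < r := by
    rcases Nat.eq_zero_or_pos r with h | h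
    · exfalso
      subst h
      have hM0 : M = 0 := by
        rw [← hMN]; ext; simp [Matrix.mul_apply]
      rw [evnorm_trace, ← hM, hM0] at hψ
      simp at hψ
    · exact h
  have hEU : ∀ v i, E v i * U = U * (Uᴴ * E v i * U) := by
    intro v i
    refine intertwine U hU N (N * Wᵀ * (F v i)ᵀ * (Wᴴ)ᵀ) hN _ ?_
    calc E v i * U * N = E v i * (U * N * Wᵀ) * (Wᴴ)ᵀ := by
          simp only [Matrix.mul_assoc, hW', Matrix.mul_one]
      _ = _ := by
          rw [hMN, hEF]
          conv_lhs => rw [← hMN]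
          simp only [Matrix.mul_assoc]
  have hFW : ∀ v i, F v i * W = W * (Wᴴ * F v i * W) := by
    intro v i
    refine intertwine W hW Nᵀ (Nᵀ * Uᵀ * (E v i)ᵀ * (Uᴴ)ᵀ) (by rwa [Matrix.det_transpose]) _ ?_
    have hU' : Uᵀ * (Uᴴ)ᵀ = 1 := by
      rw [← Matrix.transpose_mul, hU, Matrix.transpose_one]
    have hMN' : W * (Nᵀ * Uᵀ) = Mᵀ := by
      rw [← hMN]; simp [Matrix.transpose_mul, Matrix.mul_assoc]
    have hEF' : F v i * Mᵀ = Mᵀ * (E v i)ᵀ := by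
      have := congrArg Matrix.transpose (hEF v i)
      simpa [Matrix.transpose_mul] using this.symm
    calc F v i * W * Nᵀ = F v i * (W * (Nᵀ * Uᵀ)) * (Uᴴ)ᵀ := by
          simp only [Matrix.mul_assoc, hU', Matrix.mul_one]
      _ = _ := by
          rw [hMN', hEF', ← hMN']
          simp only [Matrix.mul_assoc]
  obtain ⟨VA, hVA, hVAU⟩ := exists_dil ⟨0, hr0⟩ U hU
  obtain ⟨VB, hVB, hVBW⟩ := exists_dil ⟨0, hr0⟩ W hW
  have hNof : (Matrix.of fun a b => (fun x : Fin r × Fin r => N x.1 x.2) (a, b)) = N := rfl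
  have key : ∀ (X : Matrix (Fin r) (Fin r) ℂ) (p : Fin r × Fin (dA + 1)) (q : Fin r × Fin (dB + 1)),
      (VA * (U * X * Wᵀ) * VBᵀ) p q = X p.1 q.1 * (if p.2 = 0 ∧ q.2 = 0 then 1 else 0) := by
    intro X p q
    have : VA * (U * X * Wᵀ) * VBᵀ = (VA * U) * X * (VB * W)ᵀ := by
      simp only [Matrix.transpose_mul, Matrix.mul_assoc]
    rw [this, hVAU, hVBW]
    by_cases h1 : p.2 = 0 <;> by_cases h2 : q.2 = 0 <;> simp [Matrix.mul_apply, h1, h2]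
  refine ⟨r, fun x => N x.1 x.2, fun v i => Uᴴ * E v i * U, fun v i => Wᴴ * F v i * W,
    ?_, ?_, ?_, ?_, ?_, ?_, ?_⟩
  · rw [← hψ, evnorm_trace, evnorm_trace, hNof, ← hM]
    congr 2
    conv_rhs => rw [← hMN]
    have : (U * N * Wᵀ)ᴴ * (U * N * Wᵀ) = (Wᵀ)ᴴ * (Nᴴ * N * Wᵀ) := by
      rw [Matrix.conjTranspose_mul, Matrix.conjTranspose_mul]
      calc _ = (Wᵀ)ᴴ * (Nᴴ * (Uᴴ * U) * N * Wᵀ) := by simp only [Matrix.mul_assoc]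
        _ = _ := by rw [hU, Matrix.mul_one]
    have h2 : Wᵀ * (Wᵀ)ᴴ = 1 := hW'
    rw [this, Matrix.trace_mul_comm (Wᵀ)ᴴ, Matrix.mul_assoc (Nᴴ * N), h2, Matrix.mul_one]
  · intro v i; exact (hEpos v i).conjTranspose_mul_mul_same U
  · intro v; rw [← Matrix.sum_mul, ← Matrix.mul_sum, hEsum, Matrix.mul_one, hU]
  · intro v i; exact (hFpos v i).conjTranspose_mul_mul_same W
  · intro v; rw [← Matrix.sum_mul, ← Matrix.mul_sum, hFsum, Matrix.mul_one, hW]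
  · exact hN
  · refine ⟨dA + 1, dB + 1, VA, VB, fun x => if x.1 = 0 ∧ x.2 = 0 then 1 else 0,
      hVA, hVB, ?_, ?_, ?_⟩
    · unfold evnorm
      rw [Finset.sum_eq_single (0, 0)]
      · simp
      · rintro ⟨x, y⟩ _ h
        have : ¬ (x = 0 ∧ y = 0) := fun h' => h (by rw [h'.1, h'.2])
        simp [this]
      · simp
    · apply evnorm_zero_le
      intro y
      rw [kron_mulVec, ← hM]
      conv_lhs => rw [← hMN]
      rw [key, sub_self]
    · intro v w i j
      apply evnorm_zero_le
      intro y
      have h1 : E v i * M * (F w j)ᵀ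
          = U * ((Uᴴ * E v i * U) * N * (Wᴴ * F w j * W)ᵀ) * Wᵀ := by
        calc E v i * M * (F w j)ᵀ = (E v i * U) * N * (F w j * W)ᵀ := by
              rw [← hMN]; simp only [Matrix.transpose_mul, Matrix.mul_assoc]
          _ = _ := by
              rw [hEU, hFW, Matrix.transpose_mul W]
              simp only [Matrix.mul_assoc]
      obtain ⟨⟨y1, y2⟩, y3⟩ := y
      rw [kron_mulVec, kron_mulVec', ← hM, h1, key, kron_mulVec, hNof, sub_self]

end QST
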